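/- Let T₁,T₂,T₃,T₄ be an n×n matrix representation of the Nambu–Lie 3-algebra 𝒜₄ with T₄ = t·I a scalar matrix, t ≠ 0, and suppose the underlying su(2) representation is the spin-j one, i.e. the Casimir relation T₁² + T₂² + T₃² = t^{−2} j(j+1)·I holds for some real number j with j(j+1) ≠ 0. Then the eigenvalue t of T₄ satisfies t⁴ = −j(j+1). -/

import Mathlib

/-- The Nambu commutator of three square complex matrices:
`[A,B,C]_N = ABC + BCA + CAB − BAC − ACB − CBA`. -/
noncomputable def nambu {n : ℕ} (A B C : Matrix (Fin n) (Fin n) ℂ) :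
    Matrix (Fin n) (Fin n) ℂ :=
  A * B * C + B * C * A + C * A * B - B * A * C - A * C * B - C * B * A

/-- The totally antisymmetric tensor `ε_{abcd}` on four indices with
`ε_{1234} = +1` (indices `1,2,3,4` are represented by `0,1,2,3 : Fin 4`). -/
def eps4 (a b c d : Fin 4) : ℤ :=
  ∑ σ : Equiv.Perm (Fin 4),
    if σ 0 = a ∧ σ 1 = b ∧ σ 2 = c ∧ σ 3 = d then (Equiv.Perm.sign σ : ℤ) else 0

theorem nambu_smul_one {n : ℕ} (A B : Matrix (Fin n) (Fin n) ℂ) (t : ℂ) :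
    nambu A B (t • 1) = t • (A * B - B * A) := by
  simp only [nambu, mul_smul_comm, smul_mul_assoc, mul_one, one_mul, smul_sub]
  abel

theorem nambu_eq_mul_commutators {n : ℕ} (A B C : Matrix (Fin n) (Fin n) ℂ) :
    nambu A B C = A * (B * C - C * B) + B * (C * A - A * C) + C * (A * B - B * A) := by
  simp only [nambu]
  noncomm_ring

theorem sum_eps4_zero_one_two {M : Type*} [AddCommGroup M] [Module ℂ M] (T : Fin 4 → M) :
    ∑ d, (eps4 0 1 2 d : ℂ) • T d = T 3 := by
  have h : ∀ d, eps4 0 1 2 d = if d = 3 then 1 else 0 := by decide +kernel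
  simp [h]

theorem sum_eps4_zero_one_three {M : Type*} [AddCommGroup M] [Module ℂ M] (T : Fin 4 → M) :
    ∑ d, (eps4 0 1 3 d : ℂ) • T d = -T 2 := by
  have h : ∀ d, eps4 0 1 3 d = if d = 2 then -1 else 0 := by decide +kernel
  simp [h]

theorem sum_eps4_one_two_three {M : Type*} [AddCommGroup M] [Module ℂ M] (T : Fin 4 → M) :
    ∑ d, (eps4 1 2 3 d : ℂ) • T d = -T 0 := by
  have h : ∀ d, eps4 1 2 3 d = if d = 0 then -1 else 0 := by decide +kernel
  simp [h]

theorem sum_eps4_two_zero_three {M : Type*} [AddCommGroup M] [Module ℂ M] (T : Fin 4 → M) :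
    ∑ d, (eps4 2 0 3 d : ℂ) • T d = -T 1 := by
  have h : ∀ d, eps4 2 0 3 d = if d = 1 then -1 else 0 := by decide +kernel
  simp [h]

/-- If `T₁,T₂,T₃,T₄` is an `n×n` (`n ≥ 1`) matrix representation of the
Nambu–Lie 3-algebra `𝒜₄` with `T₄ = t·I`, `t ≠ 0`, and the underlying su(2)
representation is the spin-`j` one, i.e. `T₁² + T₂² + T₃² = t⁻² j(j+1)·I`
with `j` real and `j(j+1) ≠ 0`, then `t⁴ = −j(j+1)`. -/
theorem A4_rep_spin_j_eigenvalue (n : ℕ) (hn : 0 < n)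
    (T : Fin 4 → Matrix (Fin n) (Fin n) ℂ)
    (hrep : ∀ a b c : Fin 4,
      nambu (T a) (T b) (T c) = Complex.I • ∑ d, (eps4 a b c d : ℂ) • T d)
    (t : ℂ) (ht : t ≠ 0)
    (hT4 : T 3 = t • 1)
    (j : ℝ) (hj : j * (j + 1) ≠ 0)
    (hcas : T 0 * T 0 + T 1 * T 1 + T 2 * T 2 =
      (((j * (j + 1) : ℝ) : ℂ) / t ^ 2) • (1 : Matrix (Fin n) (Fin n) ℂ)) :
    t ^ 4 = -((j * (j + 1) : ℝ) : ℂ) := by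
  have h01 := hrep 0 1 3
  have h12 := hrep 1 2 3
  have h20 := hrep 2 0 3
  have h012 := hrep 0 1 2
  rw [sum_eps4_zero_one_three, hT4, nambu_smul_one] at h01
  rw [sum_eps4_one_two_three, hT4, nambu_smul_one] at h12
  rw [sum_eps4_two_zero_three, hT4, nambu_smul_one] at h20
  rw [sum_eps4_zero_one_two, hT4, nambu_eq_mul_commutators] at h012
  have key : (t * (Complex.I * t)) • (1 : Matrix (Fin n) (Fin n) ℂ) =
      (-Complex.I * (((j * (j + 1) : ℝ) : ℂ) / t ^ 2)) • 1 := by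
    rw [mul_smul, mul_smul, ← h012, mul_smul, ← hcas, smul_add, smul_add,
      ← mul_smul_comm, ← mul_smul_comm, ← mul_smul_comm, h01, h12, h20]
    simp only [mul_smul_comm, mul_neg, smul_neg, neg_smul, smul_add]
  have hscalar := congrFun (congrFun key ⟨0, hn⟩) ⟨0, hn⟩
  simp only [Matrix.smul_apply, Matrix.one_apply_eq, smul_eq_mul, mul_one] at hscalar
  field_simp at hscalar
  linear_combination hscalar
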